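/- arXiv:2211.03216 — 4 statements merged into one kernel-verified Lean document; each statement's English description precedes it below -/
import Mathlib

section
/- Under the regularized-empirical-risk model and regularity assumptions, suppose additionally that there are constants F > 0 and g_n ≥ 1 such that ‖z_i‖ ≤ F for all i ∈ {1,…,n}, ‖z_n'‖ ≤ F, and ‖z_n − z_n'‖ ≤ F/√g_n. Then the gradient residual of the unlearned model satisfies ‖∇_w L(w', D')‖ ≤ (γ₂ F³ / (λ² n)) · min{ 4 C₁², (γ₁ C₁ F² + λ C₂ F)² / (λ² g_n) }. -/
open scoped InnerProductSpace BigOperators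

/-- A first-order Taylor remainder bound for a function with Lipschitz derivative. -/
lemma abs_taylor_remainder_le {f f' : ℝ → ℝ} {c : ℝ} (hc : 0 ≤ c)
    (hf : ∀ s, HasDerivAt f (f' s) s) (hf' : ∀ s t, |f' s - f' t| ≤ c * |s - t|) (s t : ℝ) :
    |f (s + t) - f s - f' s * t| ≤ c * t ^ 2 := by
  have hderiv : ∀ x ∈ Metric.closedBall s |t|,
      HasDerivWithinAt (fun x => f x - f' s * x) (f' x - f' s) (Metric.closedBall s |t|) x := by
    intro x _
    simpa using ((hf x).fun_sub ((hasDerivAt_id' x).const_mul (f' s))).hasDerivWithinAt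
  have hbound : ∀ x ∈ Metric.closedBall s |t|, ‖f' x - f' s‖ ≤ c * |t| := by
    intro x hx
    rw [Metric.mem_closedBall, Real.dist_eq] at hx
    exact (hf' x s).trans (by gcongr)
  have h := (convex_closedBall s |t|).norm_image_sub_le_of_norm_hasDerivWithin_le hderiv hbound
    (Metric.mem_closedBall_self (abs_nonneg t)) (y := s + t)
    (by simp [Metric.mem_closedBall])
  calc |f (s + t) - f s - f' s * t|
      = ‖f (s + t) - f' s * (s + t) - (f s - f' s * s)‖ := by rw [Real.norm_eq_abs]; ring_nf
    _ ≤ c * |t| * ‖s + t - s‖ := h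
    _ = c * t ^ 2 := by
      rw [add_sub_cancel_left, Real.norm_eq_abs, mul_assoc, abs_mul_abs_self, sq]

section RegularizedRisk

variable {E : Type*} [NormedAddCommGroup E] [InnerProductSpace ℝ E] {ι : Type*} [Fintype ι]

/-- The gradient of a regularized empirical risk vanishes at a minimizer. -/
lemma gradient_eq_zero_of_isMin_regularized_risk {f f' : ι → ℝ → ℝ}
    (hf : ∀ i s, HasDerivAt (f i) (f' i s) s) (z : ι → E) (μ : ℝ) {w : E}
    (hw : ∀ v : E, (∑ i, f i ⟪w, z i⟫_ℝ) + μ / 2 * ‖w‖ ^ 2 ≤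
      (∑ i, f i ⟪v, z i⟫_ℝ) + μ / 2 * ‖v‖ ^ 2) :
    (∑ i, f' i ⟪w, z i⟫_ℝ • z i) + μ • w = 0 := by
  set g := (∑ i, f' i ⟪w, z i⟫_ℝ • z i) + μ • w with hg
  have hline : HasDerivAt (fun t : ℝ => w + t • g) g 0 := by
    simpa using ((hasDerivAt_id (0 : ℝ)).smul_const g).const_add w
  have hloss : ∀ i, HasDerivAt (fun t : ℝ => f i ⟪w + t • g, z i⟫_ℝ)
      (f' i ⟪w, z i⟫_ℝ * ⟪g, z i⟫_ℝ) 0 := by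
    intro i
    have hinner : HasDerivAt (fun t : ℝ => ⟪w + t • g, z i⟫_ℝ) ⟪g, z i⟫_ℝ 0 := by
      simpa using hline.inner ℝ (hasDerivAt_const (0 : ℝ) (z i))
    exact HasDerivAt.comp (0 : ℝ) (h₂ := f i) (by simpa using hf i ⟪w, z i⟫_ℝ) hinner
  have hrisk : HasDerivAt
      (fun t : ℝ => (∑ i, f i ⟪w + t • g, z i⟫_ℝ) + μ / 2 * ‖w + t • g‖ ^ 2)
      ((∑ i, f' i ⟪w, z i⟫_ℝ * ⟪g, z i⟫_ℝ) + μ / 2 * (2 * ⟪w, g⟫_ℝ)) 0 := by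
    have hnorm : HasDerivAt (fun t : ℝ => ‖w + t • g‖ ^ 2) (2 * ⟪w, g⟫_ℝ) 0 := by
      simpa using hline.norm_sq
    exact (HasDerivAt.fun_sum fun i _ => hloss i).add (hnorm.const_mul (μ / 2))
  have hmin : IsLocalMin
      (fun t : ℝ => (∑ i, f i ⟪w + t • g, z i⟫_ℝ) + μ / 2 * ‖w + t • g‖ ^ 2) 0 :=
    Filter.Eventually.of_forall fun t => by simpa using hw (w + t • g)
  have hzero := hmin.hasDerivAt_eq_zero hrisk
  have hself : ⟪g, g⟫_ℝ = (∑ i, f' i ⟪w, z i⟫_ℝ * ⟪g, z i⟫_ℝ) + μ / 2 * (2 * ⟪w, g⟫_ℝ) := by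
    nth_rewrite 2 [hg]
    rw [inner_add_right, inner_sum, inner_smul_right, real_inner_comm w g]
    simp only [inner_smul_right]
    ring
  exact inner_self_eq_zero.mp (hself.trans hzero)

/-- A regularized Gram operator expands norms by at least the regularization parameter. -/
lemma mul_norm_le_norm_regularized_gram {a : ι → ℝ} (ha : ∀ i, 0 ≤ a i) (z : ι → E) (μ : ℝ)
    (v : E) : μ * ‖v‖ ≤ ‖(∑ i, (a i * ⟪v, z i⟫_ℝ) • z i) + μ • v‖ := by
  rcases eq_or_ne v 0 with rfl | hv
  · simp
  refine le_of_mul_le_mul_left ?_ (norm_pos_iff.mpr hv)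
  calc ‖v‖ * (μ * ‖v‖) = μ * ⟪v, v⟫_ℝ := by rw [real_inner_self_eq_norm_sq]; ring
    _ ≤ (∑ i, a i * ⟪v, z i⟫_ℝ * ⟪v, z i⟫_ℝ) + μ * ⟪v, v⟫_ℝ :=
      le_add_of_nonneg_left <| Finset.sum_nonneg fun i _ => by
        rw [mul_assoc]; exact mul_nonneg (ha i) (mul_self_nonneg _)
    _ = ⟪v, (∑ i, (a i * ⟪v, z i⟫_ℝ) • z i) + μ • v⟫_ℝ := by
      simp only [inner_add_right, inner_sum, inner_smul_right]
    _ ≤ _ := real_inner_le_norm _ _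

/-- After a full Newton step, the gradient of a regularized empirical risk is quadratic in the
length of the step. -/
lemma norm_gradient_newton_step_le {f' f'' : ι → ℝ → ℝ} {c F : ℝ} (hc : 0 ≤ c)
    (hf' : ∀ i s, HasDerivAt (f' i) (f'' i s) s)
    (hf'' : ∀ i s t, |f'' i s - f'' i t| ≤ c * |s - t|) {z : ι → E} (hz : ∀ i, ‖z i‖ ≤ F)
    {μ : ℝ} {w v : E}
    (hv : (∑ i, (f'' i ⟪w, z i⟫_ℝ * ⟪v, z i⟫_ℝ) • z i) + μ • v =
      -((∑ i, f' i ⟪w, z i⟫_ℝ • z i) + μ • w)) :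
    ‖(∑ i, f' i ⟪w + v, z i⟫_ℝ • z i) + μ • (w + v)‖ ≤
      Fintype.card ι * (c * F ^ 3 * ‖v‖ ^ 2) := by
  have hrem : (∑ i, f' i ⟪w + v, z i⟫_ℝ • z i) + μ • (w + v) =
      ∑ i, (f' i (⟪w, z i⟫_ℝ + ⟪v, z i⟫_ℝ) - f' i ⟪w, z i⟫_ℝ -
        f'' i ⟪w, z i⟫_ℝ * ⟪v, z i⟫_ℝ) • z i := by
    simp only [sub_smul, Finset.sum_sub_distrib, inner_add_left, smul_add]
    rw [eq_neg_iff_add_eq_zero] at hv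
    rw [← sub_eq_zero, ← hv]
    abel
  rw [hrem, ← nsmul_eq_mul]
  refine (norm_sum_le _ _).trans (Finset.sum_le_card_nsmul _ _ _ fun i _ => ?_)
  have hinner : ⟪v, z i⟫_ℝ ^ 2 ≤ (‖v‖ * F) ^ 2 := by
    rw [← sq_abs]
    exact pow_le_pow_left₀ (abs_nonneg _)
      ((abs_real_inner_le_norm _ _).trans (by gcongr; exact hz i)) 2
  rw [norm_smul, Real.norm_eq_abs]
  calc _ ≤ (c * (‖v‖ * F) ^ 2) * F :=
      mul_le_mul ((abs_taylor_remainder_le hc (hf' i) (hf'' i) _ _).trans (by gcongr)) (hz i)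
        (norm_nonneg _) (by positivity)
    _ = c * F ^ 3 * ‖v‖ ^ 2 := by ring

end RegularizedRisk

/-- The action of a regularized weighted Gram matrix on a vector. -/
lemma toEuclideanLin_regularized_gram {m ι : Type*} [Fintype m] [DecidableEq m] [Fintype ι]
    (a : ι → ℝ) (z : ι → EuclideanSpace ℝ m) (μ : ℝ) (v : EuclideanSpace ℝ m) :
    Matrix.toEuclideanLin ((∑ i, a i • Matrix.vecMulVec (z i) (z i)) + μ • (1 : Matrix m m ℝ)) v =
      (∑ i, (a i * ⟪v, z i⟫_ℝ) • z i) + μ • v := by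
  ext j
  simp [Matrix.toLpLin_apply, Matrix.vecMulVec_mulVec, PiLp.inner_apply, dotProduct, mul_comm,
    mul_left_comm]

/-- A weighted Gram matrix with nonnegative weights and positive regularization is positive
definite. -/
lemma posDef_regularized_gram {m ι : Type*} [Fintype m] [DecidableEq m] [Fintype ι]
    {a : ι → ℝ} (ha : ∀ i, 0 ≤ a i) (z : ι → EuclideanSpace ℝ m) {μ : ℝ} (hμ : 0 < μ) :
    ((∑ i, a i • Matrix.vecMulVec (z i) (z i)) + μ • (1 : Matrix m m ℝ)).PosDef :=
  Matrix.PosDef.posSemidef_add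
    (Matrix.posSemidef_sum _ fun i _ =>
      (by simpa using Matrix.posSemidef_vecMulVec_self_star (z i : m → ℝ) :
        (Matrix.vecMulVec (z i) (z i)).PosSemidef).smul (ha i))
    (Matrix.PosDef.one.smul hμ)

/-- Theorem 2 / feature-removal worst-case bound.
Under the regularized-empirical-risk model and regularity assumptions, if `‖z i‖ ≤ F`,
`‖znew‖ ≤ F` and `‖z k - znew‖ ≤ F / √gₙ`, then the gradient residual of the unlearned
model satisfies
`‖∇L(w', D')‖ ≤ (γ₂ F³ / (λ² n)) · min {4C₁², (γ₁C₁F² + λC₂F)² / (λ² gₙ)}`. -/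
theorem gradient_residual_feature_removal
    (d n : ℕ) (hn : 1 ≤ n) (lam : ℝ) (hlam : 0 < lam)
    -- the loss `ℓ`, twice continuously differentiable in its first argument,
    -- with first and second partial derivatives `dl` and `ddl`
    (ℓ dl ddl : ℝ → ℝ → ℝ)
    (hdl : ∀ (yy s : ℝ), HasDerivAt (fun t => ℓ t yy) (dl s yy) s)
    (hddl : ∀ (yy s : ℝ), HasDerivAt (fun t => dl t yy) (ddl s yy) s)
    (hddl_cont : ∀ yy : ℝ, Continuous fun s => ddl s yy)
    (hddl_nonneg : ∀ s yy : ℝ, 0 ≤ ddl s yy)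
    -- the dataset `D = ((z i, y i))_i` and the updated dataset `D'`, obtained by
    -- replacing the embedding `z k` by `znew`
    (z : Fin n → EuclideanSpace ℝ (Fin d)) (y : Fin n → ℝ)
    (k : Fin n) (znew : EuclideanSpace ℝ (Fin d))
    (z' : Fin n → EuclideanSpace ℝ (Fin d)) (hz' : z' = Function.update z k znew)
    -- `wstar` minimizes the regularized empirical risk `L(·, D)`
    (wstar : EuclideanSpace ℝ (Fin d))
    (hwstar : ∀ w : EuclideanSpace ℝ (Fin d),
      (∑ i, ℓ ⟪wstar, z i⟫_ℝ (y i)) + lam * n / 2 * ‖wstar‖ ^ 2 ≤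
        (∑ i, ℓ ⟪w, z i⟫_ℝ (y i)) + lam * n / 2 * ‖w‖ ^ 2)
    -- regularity assumptions
    (C1 C2 γ1 γ2 : ℝ)
    (hC1pos : 0 < C1) (hC2pos : 0 < C2) (hγ1pos : 0 < γ1) (hγ2pos : 0 < γ2)
    (hC1 : ∀ (w : EuclideanSpace ℝ (Fin d)) (yy : ℝ) (i : Fin n),
      ‖dl ⟪w, z i⟫_ℝ yy • z i‖ ≤ C1 ∧ ‖dl ⟪w, z' i⟫_ℝ yy • z' i‖ ≤ C1)
    (hC2 : ∀ s yy : ℝ, |dl s yy| ≤ C2)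
    (hγ1 : ∀ (yy s t : ℝ), |dl s yy - dl t yy| ≤ γ1 * |s - t|)
    (hγ2 : ∀ (yy s t : ℝ), |ddl s yy - ddl t yy| ≤ γ2 * |s - t|)
    -- the additional boundedness assumptions
    (F gn : ℝ) (hF : 0 < F) (hgn : 1 ≤ gn)
    (hzF : ∀ i, ‖z i‖ ≤ F) (hznewF : ‖znew‖ ≤ F)
    (hclose : ‖z k - znew‖ ≤ F / Real.sqrt gn)
    -- the Hessian `H = ∇²L(wstar, D')`, the gradient difference `Δ`, and the
    -- unlearned model `w' = wstar + H⁻¹ Δ`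
    (H : Matrix (Fin d) (Fin d) ℝ)
    (hH : H = (∑ i, ddl ⟪wstar, z' i⟫_ℝ (y i) • Matrix.vecMulVec (z' i) (z' i)) +
      (lam * n) • (1 : Matrix (Fin d) (Fin d) ℝ))
    (Δ : EuclideanSpace ℝ (Fin d))
    (hΔ : Δ = dl ⟪wstar, z k⟫_ℝ (y k) • z k - dl ⟪wstar, znew⟫_ℝ (y k) • znew)
    (w' : EuclideanSpace ℝ (Fin d))
    (hw' : w' = wstar + Matrix.toEuclideanLin H⁻¹ Δ) :
    -- conclusion: bound on the gradient residual `‖∇L(w', D')‖`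
    ‖(∑ i, dl ⟪w', z' i⟫_ℝ (y i) • z' i) + (lam * n) • w'‖ ≤
      γ2 * F ^ 3 / (lam ^ 2 * n) *
        min (4 * C1 ^ 2) ((γ1 * C1 * F ^ 2 + lam * C2 * F) ^ 2 / (lam ^ 2 * gn)) := by
  have hn' : (0 : ℝ) < n := by exact_mod_cast hn
  have hμ : 0 < lam * n := mul_pos hlam hn'
  have hzF' : ∀ i, ‖z' i‖ ≤ F := by
    intro i
    rcases eq_or_ne i k with rfl | hi
    · simpa [hz'] using hznewF
    · simpa [hz', hi] using hzF i
  have hgrad : (∑ i, dl ⟪wstar, z i⟫_ℝ (y i) • z i) + (lam * n) • wstar = 0 :=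
    gradient_eq_zero_of_isMin_regularized_risk (f := fun i s => ℓ s (y i))
      (fun i => hdl (y i)) z (lam * n) hwstar
  have hgrad' : (∑ i, dl ⟪wstar, z' i⟫_ℝ (y i) • z' i) + (lam * n) • wstar = -Δ := by
    have hsum : ∑ i, (dl ⟪wstar, z i⟫_ℝ (y i) • z i - dl ⟪wstar, z' i⟫_ℝ (y i) • z' i) = Δ := by
      rw [Finset.sum_eq_single k (fun i _ hi => by simp [hz', hi]) (by simp), hΔ]
      simp [hz']
    rw [← hsum, Finset.sum_sub_distrib, neg_sub, sub_eq_add_neg, add_right_inj]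
    exact (neg_eq_of_add_eq_zero_right hgrad).symm
  set v := Matrix.toEuclideanLin H⁻¹ Δ with hv
  have hHv : (∑ i, (ddl ⟪wstar, z' i⟫_ℝ (y i) * ⟪v, z' i⟫_ℝ) • z' i) + (lam * n) • v = Δ := by
    have hdet : IsUnit H.det := by
      rw [← Matrix.isUnit_iff_isUnit_det, hH]
      exact (posDef_regularized_gram (fun i => hddl_nonneg _ _) z' hμ).isUnit
    rw [← toEuclideanLin_regularized_gram, ← hH, hv]
    simp [Matrix.toLpLin_apply, Matrix.mulVec_mulVec, Matrix.mul_nonsing_inv H hdet]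
  have hvΔ : lam * n * ‖v‖ ≤ ‖Δ‖ := by
    simpa only [hHv] using mul_norm_le_norm_regularized_gram
      (fun i => hddl_nonneg ⟪wstar, z' i⟫_ℝ (y i)) z' (lam * n) v
  have hres := norm_gradient_newton_step_le hγ2pos.le (fun i => hddl (y i))
    (fun i => hγ2 (y i)) hzF' (hHv.trans (by rw [hgrad', neg_neg]))
  have hwnorm : ‖wstar‖ ≤ C1 / lam := by
    have hle : lam * n * ‖wstar‖ ≤ n * C1 := by
      calc lam * n * ‖wstar‖ = ‖∑ i, dl ⟪wstar, z i⟫_ℝ (y i) • z i‖ := by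
            rw [eq_neg_of_add_eq_zero_left hgrad, norm_neg, norm_smul, Real.norm_of_nonneg hμ.le]
        _ ≤ n * C1 := by
            simpa using (norm_sum_le _ _).trans (Finset.sum_le_card_nsmul Finset.univ _ _
              fun i _ => (hC1 wstar (y i) i).1)
    rw [le_div_iff₀ hlam]
    exact le_of_mul_le_mul_left (by linarith) hn'
  have hΔC1 : ‖Δ‖ ≤ 2 * C1 := by
    have hnew : ‖dl ⟪wstar, znew⟫_ℝ (y k) • znew‖ ≤ C1 := by
      simpa [hz'] using (hC1 wstar (y k) k).2
    rw [hΔ, two_mul]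
    exact (norm_sub_le _ _).trans (add_le_add (hC1 wstar (y k) k).1 hnew)
  have hΔg : ‖Δ‖ ≤ (γ1 * C1 * F ^ 2 + lam * C2 * F) / (lam * Real.sqrt gn) := by
    have hg : 0 < Real.sqrt gn := Real.sqrt_pos.mpr (by linarith)
    have hsplit : Δ = (dl ⟪wstar, z k⟫_ℝ (y k) - dl ⟪wstar, znew⟫_ℝ (y k)) • z k +
        dl ⟪wstar, znew⟫_ℝ (y k) • (z k - znew) := by
      rw [hΔ, sub_smul, smul_sub]; abel
    have hdiff : |dl ⟪wstar, z k⟫_ℝ (y k) - dl ⟪wstar, znew⟫_ℝ (y k)| ≤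
        γ1 * (C1 / lam * (F / Real.sqrt gn)) := by
      refine (hγ1 _ _ _).trans ?_
      rw [← inner_sub_right]
      gcongr
      exact (abs_real_inner_le_norm _ _).trans (by gcongr)
    calc ‖Δ‖ ≤ |dl ⟪wstar, z k⟫_ℝ (y k) - dl ⟪wstar, znew⟫_ℝ (y k)| * ‖z k‖ +
          |dl ⟪wstar, znew⟫_ℝ (y k)| * ‖z k - znew‖ := by
          rw [hsplit]
          exact (norm_add_le _ _).trans_eq (by simp only [norm_smul, Real.norm_eq_abs])
      _ ≤ γ1 * (C1 / lam * (F / Real.sqrt gn)) * F + C2 * (F / Real.sqrt gn) := by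
          gcongr
          · exact hzF k
          · exact hC2 _ _
      _ = _ := by field_simp
  have hΔsq : ‖Δ‖ ^ 2 ≤
      min (4 * C1 ^ 2) ((γ1 * C1 * F ^ 2 + lam * C2 * F) ^ 2 / (lam ^ 2 * gn)) := by
    refine le_min ((pow_le_pow_left₀ (norm_nonneg _) hΔC1 2).trans_eq (by ring)) ?_
    refine (pow_le_pow_left₀ (norm_nonneg _) hΔg 2).trans_eq ?_
    rw [div_pow, mul_pow, Real.sq_sqrt (by linarith)]
  rw [hw']
  calc _ ≤ n * (γ2 * F ^ 3 * ‖v‖ ^ 2) := by simpa using hres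
    _ = γ2 * F ^ 3 / (lam ^ 2 * n) * (lam * n * ‖v‖) ^ 2 := by field_simp
    _ ≤ γ2 * F ^ 3 / (lam ^ 2 * n) * ‖Δ‖ ^ 2 := by gcongr
    _ ≤ _ := by gcongr
end

section
/- Under the regularized-empirical-risk model and regularity assumptions, suppose additionally that there is a constant F > 0 such that ‖z_i‖ ≤ F for all i ∈ {1,…,n} and ‖z_n'‖ ≤ F. Then the gradient residual of the unlearned model satisfies ‖∇_w L(w', D')‖ ≤ 4 γ₂ C₁² F³ / (λ² n). -/
open scoped InnerProductSpace BigOperators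

/-- First-order Taylor remainder bound for a function with Lipschitz derivative. -/
lemma abs_sub_sub_mul_le_of_lipschitz_deriv {f f' : ℝ → ℝ} {γ : ℝ}
    (hf : ∀ s, HasDerivAt f (f' s) s) (hγ : 0 ≤ γ)
    (hlip : ∀ s t, |f' s - f' t| ≤ γ * |s - t|) (s t : ℝ) :
    |f t - f s - f' s * (t - s)| ≤ γ * |t - s| ^ 2 := by
  have hderiv : ∀ x ∈ Set.uIcc s t,
      HasDerivWithinAt (fun x => f x - f' s * x) (f' x - f' s) (Set.uIcc s t) x := fun x _ => by
    simpa using ((hf x).fun_sub ((hasDerivAt_id x).const_mul (f' s))).hasDerivWithinAt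
  have hbound : ∀ x ∈ Set.uIcc s t, ‖f' x - f' s‖ ≤ γ * |t - s| := fun x hx =>
    (hlip x s).trans (by gcongr γ * ?_; exact Set.abs_sub_left_of_mem_uIcc hx)
  have := (convex_uIcc s t).norm_image_sub_le_of_norm_hasDerivWithin_le hderiv hbound
    Set.left_mem_uIcc Set.right_mem_uIcc
  rw [Real.norm_eq_abs, Real.norm_eq_abs] at this
  calc |f t - f s - f' s * (t - s)| = |f t - f' s * t - (f s - f' s * s)| := by ring_nf
    _ ≤ γ * |t - s| * |t - s| := this
    _ = γ * |t - s| ^ 2 := by ring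

/-- The first-order optimality condition for a ridge-regularized sum of functions of linear
forms. -/
lemma sum_smul_add_smul_eq_zero_of_forall_le {E ι : Type*} [NormedAddCommGroup E]
    [InnerProductSpace ℝ E] [Fintype ι] {φ φ' : ι → ℝ → ℝ}
    (hφ : ∀ i s, HasDerivAt (φ i) (φ' i s) s) (z : ι → E) (c : ℝ) {w₀ : E}
    (hmin : ∀ w : E, (∑ i, φ i ⟪w₀, z i⟫_ℝ) + c / 2 * ‖w₀‖ ^ 2 ≤
      (∑ i, φ i ⟪w, z i⟫_ℝ) + c / 2 * ‖w‖ ^ 2) :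
    (∑ i, φ' i ⟪w₀, z i⟫_ℝ • z i) + c • w₀ = 0 := by
  refine ext_inner_right ℝ fun u => ?_
  have hline : HasDerivAt (fun t : ℝ => w₀ + t • u) u 0 := by
    simpa using ((hasDerivAt_id (0 : ℝ)).smul_const u).const_add w₀
  have hterm : ∀ i, HasDerivAt (fun t : ℝ => φ i ⟪w₀ + t • u, z i⟫_ℝ)
      (φ' i ⟪w₀, z i⟫_ℝ * ⟪u, z i⟫_ℝ) 0 := fun i => by
    have h := hline.inner ℝ (hasDerivAt_const (0 : ℝ) (z i))
    simp only [inner_zero_right, zero_add] at h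
    exact HasDerivAt.comp (0 : ℝ) (by simpa using hφ i _) h
  have hderiv := (HasDerivAt.fun_sum fun i (_ : i ∈ Finset.univ) => hterm i).add
    (hline.norm_sq.const_mul (c / 2))
  have hloc : IsLocalMin ((fun t : ℝ => ∑ i, φ i ⟪w₀ + t • u, z i⟫_ℝ) +
      fun t : ℝ => c / 2 * ‖w₀ + t • u‖ ^ 2) 0 :=
    Filter.Eventually.of_forall fun t => by simpa using hmin (w₀ + t • u)
  have hzero := hloc.hasDerivAt_eq_zero hderiv
  simp only [zero_smul, add_zero, real_inner_comm _ u] at hzero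
  simp only [inner_add_left, sum_inner, real_inner_smul_left, inner_zero_left]
  linear_combination hzero

/-- The action on Euclidean space of a weighted sum of rank-one matrices plus a multiple of the
identity. -/
lemma toEuclideanLin_sum_vecMulVec_add_smul_one {ι κ : Type*} [Fintype ι] [Fintype κ]
    [DecidableEq κ] (a : ι → ℝ) (z : ι → EuclideanSpace ℝ κ) (c : ℝ) (v : EuclideanSpace ℝ κ) :
    Matrix.toEuclideanLin ((∑ i, a i • Matrix.vecMulVec (z i) (z i)) +
      c • (1 : Matrix κ κ ℝ)) v = (∑ i, (a i * ⟪v, z i⟫_ℝ) • z i) + c • v := by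
  ext j
  simp [Matrix.vecMulVec_mulVec, PiLp.inner_apply, dotProduct, mul_comm, mul_left_comm]

/-- A linear endomorphism whose quadratic form is bounded below by `c` expands norms by at least
`c`. -/
lemma mul_norm_le_norm_of_mul_norm_sq_le_inner {E : Type*} [NormedAddCommGroup E]
    [InnerProductSpace ℝ E] {c : ℝ} {x v : E} (h : c * ‖v‖ ^ 2 ≤ ⟪x, v⟫_ℝ) :
    c * ‖v‖ ≤ ‖x‖ := by
  rcases (norm_nonneg v).eq_or_lt with hv | hv
  · simp [← hv]
  · refine le_of_mul_le_mul_right ?_ hv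
    calc c * ‖v‖ * ‖v‖ = c * ‖v‖ ^ 2 := by ring
      _ ≤ ‖x‖ * ‖v‖ := h.trans (real_inner_le_norm x v)

/-- An expanding matrix is invertible: applying it after its inverse is the identity. -/
lemma toEuclideanLin_toEuclideanLin_inv {κ : Type*} [Fintype κ] [DecidableEq κ]
    {H : Matrix κ κ ℝ} {c : ℝ} (hc : 0 < c)
    (hH : ∀ v, c * ‖v‖ ≤ ‖Matrix.toEuclideanLin H v‖) (x : EuclideanSpace ℝ κ) :
    Matrix.toEuclideanLin H (Matrix.toEuclideanLin H⁻¹ x) = x := by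
  have hunit : IsUnit H := by
    rw [← Matrix.mulVec_injective_iff_isUnit]
    refine (injective_iff_map_eq_zero (Matrix.mulVecLin H)).2 fun v hv => ?_
    have h := hH (WithLp.toLp 2 v)
    have hz : Matrix.toEuclideanLin H (WithLp.toLp 2 v) = 0 := by
      rw [Matrix.toLpLin_apply]
      exact congrArg (WithLp.toLp 2) hv
    rw [hz, norm_zero] at h
    have h0 : ‖WithLp.toLp 2 v‖ = 0 :=
      le_antisymm (nonpos_of_mul_nonpos_right h hc) (norm_nonneg _)
    simpa using h0
  have hdet := (Matrix.isUnit_iff_isUnit_det H).1 hunit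
  simp [Matrix.toLpLin_apply, Matrix.mulVec_mulVec, Matrix.mul_nonsing_inv _ hdet]

/-- Theorem 3 / node-removal worst-case bound.
Under the regularized-empirical-risk model and regularity assumptions, if all embeddings
are bounded in norm by `F`, then the gradient residual of the unlearned model satisfies
`‖∇L(w', D')‖ ≤ 4 γ₂ C₁² F³ / (λ² n)`. -/
theorem gradient_residual_node_removal
    (d n : ℕ) (hn : 1 ≤ n) (lam : ℝ) (hlam : 0 < lam)
    -- the loss `ℓ`, twice continuously differentiable in its first argument,
    -- with first and second partial derivatives `dl` and `ddl`
    (ℓ dl ddl : ℝ → ℝ → ℝ)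
    (hdl : ∀ (yy s : ℝ), HasDerivAt (fun t => ℓ t yy) (dl s yy) s)
    (hddl : ∀ (yy s : ℝ), HasDerivAt (fun t => dl t yy) (ddl s yy) s)
    (hddl_cont : ∀ yy : ℝ, Continuous fun s => ddl s yy)
    (hddl_nonneg : ∀ s yy : ℝ, 0 ≤ ddl s yy)
    -- the dataset `D = ((z i, y i))_i` and the updated dataset `D'`, obtained by
    -- replacing the embedding `z k` by `znew`
    (z : Fin n → EuclideanSpace ℝ (Fin d)) (y : Fin n → ℝ)
    (k : Fin n) (znew : EuclideanSpace ℝ (Fin d))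
    (z' : Fin n → EuclideanSpace ℝ (Fin d)) (hz' : z' = Function.update z k znew)
    -- `wstar` minimizes the regularized empirical risk `L(·, D)`
    (wstar : EuclideanSpace ℝ (Fin d))
    (hwstar : ∀ w : EuclideanSpace ℝ (Fin d),
      (∑ i, ℓ ⟪wstar, z i⟫_ℝ (y i)) + lam * n / 2 * ‖wstar‖ ^ 2 ≤
        (∑ i, ℓ ⟪w, z i⟫_ℝ (y i)) + lam * n / 2 * ‖w‖ ^ 2)
    -- regularity assumptions
    (C1 C2 γ1 γ2 : ℝ)
    (hC1pos : 0 < C1) (hC2pos : 0 < C2) (hγ1pos : 0 < γ1) (hγ2pos : 0 < γ2)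
    (hC1 : ∀ (w : EuclideanSpace ℝ (Fin d)) (yy : ℝ) (i : Fin n),
      ‖dl ⟪w, z i⟫_ℝ yy • z i‖ ≤ C1 ∧ ‖dl ⟪w, z' i⟫_ℝ yy • z' i‖ ≤ C1)
    (hC2 : ∀ s yy : ℝ, |dl s yy| ≤ C2)
    (hγ1 : ∀ (yy s t : ℝ), |dl s yy - dl t yy| ≤ γ1 * |s - t|)
    (hγ2 : ∀ (yy s t : ℝ), |ddl s yy - ddl t yy| ≤ γ2 * |s - t|)
    -- the additional boundedness assumptions
    (F : ℝ) (hF : 0 < F)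
    (hzF : ∀ i, ‖z i‖ ≤ F) (hznewF : ‖znew‖ ≤ F)
    -- the Hessian `H = ∇²L(wstar, D')`, the gradient difference `Δ`, and the
    -- unlearned model `w' = wstar + H⁻¹ Δ`
    (H : Matrix (Fin d) (Fin d) ℝ)
    (hH : H = (∑ i, ddl ⟪wstar, z' i⟫_ℝ (y i) • Matrix.vecMulVec (z' i) (z' i)) +
      (lam * n) • (1 : Matrix (Fin d) (Fin d) ℝ))
    (Δ : EuclideanSpace ℝ (Fin d))
    (hΔ : Δ = dl ⟪wstar, z k⟫_ℝ (y k) • z k - dl ⟪wstar, znew⟫_ℝ (y k) • znew)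
    (w' : EuclideanSpace ℝ (Fin d))
    (hw' : w' = wstar + Matrix.toEuclideanLin H⁻¹ Δ) :
    -- conclusion: bound on the gradient residual `‖∇L(w', D')‖`
    ‖(∑ i, dl ⟪w', z' i⟫_ℝ (y i) • z' i) + (lam * n) • w'‖ ≤
      4 * γ2 * C1 ^ 2 * F ^ 3 / (lam ^ 2 * n) := by
  have hn0 : (0 : ℝ) < n := by exact_mod_cast hn
  have hc : 0 < lam * n := mul_pos hlam hn0
  have hz'F : ∀ i, ‖z' i‖ ≤ F := fun i => by
    rw [hz', Function.update_apply]
    split_ifs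
    exacts [hznewF, hzF i]
  have hHapply : ∀ v, Matrix.toEuclideanLin H v =
      (∑ i, (ddl ⟪wstar, z' i⟫_ℝ (y i) * ⟪v, z' i⟫_ℝ) • z' i) + (lam * n) • v := fun v => by
    rw [hH, toEuclideanLin_sum_vecMulVec_add_smul_one]
  have hexpand : ∀ v, lam * n * ‖v‖ ≤ ‖Matrix.toEuclideanLin H v‖ := fun v => by
    refine mul_norm_le_norm_of_mul_norm_sq_le_inner ?_
    rw [hHapply, inner_add_left, real_inner_smul_left, real_inner_self_eq_norm_sq, sum_inner]
    refine le_add_of_nonneg_left (Finset.sum_nonneg fun i _ => ?_)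
    rw [real_inner_smul_left, real_inner_comm v, mul_assoc]
    exact mul_nonneg (hddl_nonneg _ _) (mul_self_nonneg _)
  set v := Matrix.toEuclideanLin H⁻¹ Δ with hv
  have hHv : Matrix.toEuclideanLin H v = Δ := toEuclideanLin_toEuclideanLin_inv hc hexpand Δ
  have hΔnorm : ‖Δ‖ ≤ 2 * C1 := by
    have hold := (hC1 wstar (y k) k).1
    have hnew := (hC1 wstar (y k) k).2
    rw [hz', Function.update_self] at hnew
    rw [hΔ]
    linarith [norm_sub_le (dl ⟪wstar, z k⟫_ℝ (y k) • z k) (dl ⟪wstar, znew⟫_ℝ (y k) • znew)]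
  have hvnorm : ‖v‖ ≤ 2 * C1 / (lam * n) := by
    rw [le_div_iff₀ hc]
    linarith [hHv ▸ hexpand v]
  have hopt : (∑ i, dl ⟪wstar, z i⟫_ℝ (y i) • z i) + (lam * n) • wstar = 0 :=
    sum_smul_add_smul_eq_zero_of_forall_le (φ := fun i s => ℓ s (y i))
      (φ' := fun i s => dl s (y i)) (fun i s => hdl (y i) s) z (lam * n) hwstar
  have hgrad : (∑ i, dl ⟪wstar, z' i⟫_ℝ (y i) • z' i) + (lam * n) • wstar = -Δ := by
    have hsum : (∑ i, dl ⟪wstar, z i⟫_ℝ (y i) • z i) -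
        ∑ i, dl ⟪wstar, z' i⟫_ℝ (y i) • z' i = Δ := by
      rw [← Finset.sum_sub_distrib, Finset.sum_eq_single k]
      · rw [hΔ, hz', Function.update_self]
      · intro i _ hik
        rw [hz', Function.update_of_ne hik, sub_self]
      · simp
    rw [← hsum, neg_sub, eq_sub_iff_add_eq, add_assoc, add_comm _ (∑ i, _ • z i), hopt, add_zero]
  have hresidual : (∑ i, dl ⟪w', z' i⟫_ℝ (y i) • z' i) + (lam * n) • w' =
      ∑ i, (dl ⟪w', z' i⟫_ℝ (y i) - dl ⟪wstar, z' i⟫_ℝ (y i) -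
        ddl ⟪wstar, z' i⟫_ℝ (y i) * (⟪w', z' i⟫_ℝ - ⟪wstar, z' i⟫_ℝ)) • z' i := by
    have hdiff : ∀ i, ⟪w', z' i⟫_ℝ - ⟪wstar, z' i⟫_ℝ = ⟪v, z' i⟫_ℝ := fun i => by
      rw [hw', inner_add_left, add_sub_cancel_left]
    simp only [hdiff, sub_smul, Finset.sum_sub_distrib]
    have hHv' := (hHapply v).symm.trans hHv
    rw [eq_sub_of_add_eq hHv', eq_sub_of_add_eq hgrad, hw', smul_add]
    abel
  rw [hresidual]
  have hterm : ∀ i ∈ Finset.univ, ‖(dl ⟪w', z' i⟫_ℝ (y i) - dl ⟪wstar, z' i⟫_ℝ (y i) -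
        ddl ⟪wstar, z' i⟫_ℝ (y i) * (⟪w', z' i⟫_ℝ - ⟪wstar, z' i⟫_ℝ)) • z' i‖ ≤
      γ2 * (2 * C1 / (lam * n) * F) ^ 2 * F := fun i _ => by
    have hstep : |⟪w', z' i⟫_ℝ - ⟪wstar, z' i⟫_ℝ| ≤ 2 * C1 / (lam * n) * F := by
      rw [hw', inner_add_left, add_sub_cancel_left]
      exact (abs_real_inner_le_norm _ _).trans
        (mul_le_mul hvnorm (hz'F i) (norm_nonneg _) (by positivity))
    rw [norm_smul, Real.norm_eq_abs]
    refine mul_le_mul ?_ (hz'F i) (norm_nonneg _) (by positivity)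
    refine (abs_sub_sub_mul_le_of_lipschitz_deriv (hddl (y i)) hγ2pos.le (hγ2 (y i)) _ _).trans ?_
    gcongr
  refine (norm_sum_le_of_le _ hterm).trans (le_of_eq ?_)
  rw [Finset.sum_const, Finset.card_univ, Fintype.card_fin, nsmul_eq_mul]
  field_simp
  ring
end

section
/- Under the batch-removal regularized-empirical-risk model and regularity assumptions, suppose additionally that there are constants F > 0 and g ≥ 1 such that ‖z_i‖ ≤ F and ‖z_i'‖ ≤ F for all i ∈ {1,…,n}, and ‖z_i − z_i'‖ ≤ F/√g for every i in the removal set S with |S| = m. Then the gradient residual of the unlearned model satisfies ‖∇_w L(w', D')‖ ≤ (γ₂ m² F³ / (λ² n)) · min{ 4 C₁², (γ₁ C₁ F² + λ C₂ F)² / (λ² g) }. -/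
open scoped InnerProductSpace BigOperators

lemma mul_norm_le_norm_sum_inner_smul_add_smul {ι E : Type*} [Fintype ι]
    [NormedAddCommGroup E] [InnerProductSpace ℝ E] {a : ι → ℝ} (ha : ∀ i, 0 ≤ a i)
    (z : ι → E) (c : ℝ) (v : E) :
    c * ‖v‖ ≤ ‖(∑ i, (a i * ⟪v, z i⟫_ℝ) • z i) + c • v‖ := by
  rcases eq_or_ne v 0 with rfl | hv
  · simp
  have hpos : 0 < ‖v‖ := norm_pos_iff.mpr hv
  have hquad : c * ‖v‖ * ‖v‖ ≤ ⟪v, (∑ i, (a i * ⟪v, z i⟫_ℝ) • z i) + c • v⟫_ℝ := by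
    rw [inner_add_right, inner_sum, real_inner_smul_right, real_inner_self_eq_norm_mul_norm]
    have : 0 ≤ ∑ i, ⟪v, (a i * ⟪v, z i⟫_ℝ) • z i⟫_ℝ := by
      refine Finset.sum_nonneg fun i _ => ?_
      rw [real_inner_smul_right, mul_assoc]
      exact mul_nonneg (ha i) (mul_self_nonneg _)
    linarith
  have hcs := real_inner_le_norm v ((∑ i, (a i * ⟪v, z i⟫_ℝ) • z i) + c • v)
  refine le_of_mul_le_mul_right ?_ hpos
  linarith

lemma toEuclideanLin_nonsing_inv_apply {κ : Type*} [Fintype κ] [DecidableEq κ]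
    {H : Matrix κ κ ℝ} (hH : Function.Injective (Matrix.toEuclideanLin H))
    (v : EuclideanSpace ℝ κ) :
    Matrix.toEuclideanLin H (Matrix.toEuclideanLin H⁻¹ v) = v := by
  have hunit : IsUnit H := by
    refine Matrix.mulVec_injective_iff_isUnit.mp fun x x' hx => ?_
    have := @hH (WithLp.toLp 2 x) (WithLp.toLp 2 x') (by
      simpa [Matrix.toEuclideanLin] using hx)
    simpa using this
  have hdet := (Matrix.isUnit_iff_isUnit_det H).mp hunit
  ext j
  simp [Matrix.toEuclideanLin, Matrix.mulVec_mulVec, Matrix.mul_nonsing_inv H hdet]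

lemma abs_sub_sub_deriv_mul_le {f f' : ℝ → ℝ} {K : ℝ} (hK : 0 ≤ K)
    (hf : ∀ s, HasDerivAt f (f' s) s) (hf' : ∀ s t, |f' s - f' t| ≤ K * |s - t|) (s t : ℝ) :
    |f (s + t) - f s - f' s * t| ≤ K * t ^ 2 := by
  have hderiv (r : ℝ) (_ : r ∈ Set.uIcc s (s + t)) :
      HasDerivWithinAt (fun r => f r - f' s * r) (f' r - f' s) (Set.uIcc s (s + t)) r := by
    simpa using ((hf r).fun_sub ((hasDerivAt_id' r).const_mul (f' s))).hasDerivWithinAt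
  have hbound (r : ℝ) (hr : r ∈ Set.uIcc s (s + t)) : ‖f' r - f' s‖ ≤ K * |t| := by
    refine (hf' r s).trans (mul_le_mul_of_nonneg_left ?_ hK)
    simpa using Set.abs_sub_left_of_mem_uIcc hr
  have := (convex_uIcc s (s + t)).norm_image_sub_le_of_norm_hasDerivWithin_le hderiv hbound
    Set.left_mem_uIcc Set.right_mem_uIcc
  rw [Real.norm_eq_abs, Real.norm_eq_abs, add_sub_cancel_left, mul_assoc, abs_mul_abs_self] at this
  convert this using 1
  · congr 1; ring
  · ring

lemma regularized_gradient_eq_zero_of_forall_le {ι E : Type*} [Fintype ι]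
    [NormedAddCommGroup E] [InnerProductSpace ℝ E] {f f' : ι → ℝ → ℝ}
    (hf : ∀ i s, HasDerivAt (f i) (f' i s) s) (z : ι → E) (c : ℝ) {w₀ : E}
    (hmin : ∀ w, (∑ i, f i ⟪w₀, z i⟫_ℝ) + c / 2 * ‖w₀‖ ^ 2 ≤
      (∑ i, f i ⟪w, z i⟫_ℝ) + c / 2 * ‖w‖ ^ 2) :
    (∑ i, f' i ⟪w₀, z i⟫_ℝ • z i) + c • w₀ = 0 := by
  set G := (∑ i, f' i ⟪w₀, z i⟫_ℝ • z i) + c • w₀ with hG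
  have hline : HasDerivAt (fun t : ℝ => w₀ + t • G) G 0 := by
    simpa using ((hasDerivAt_id (0 : ℝ)).smul_const G).const_add w₀
  have hloss (i : ι) : HasDerivAt (fun t : ℝ => f i ⟪w₀ + t • G, z i⟫_ℝ)
      (f' i ⟪w₀, z i⟫_ℝ * ⟪G, z i⟫_ℝ) 0 := by
    have hinner : HasDerivAt (fun t : ℝ => ⟪w₀ + t • G, z i⟫_ℝ) ⟪G, z i⟫_ℝ 0 := by
      simpa using hline.inner ℝ (hasDerivAt_const (0 : ℝ) (z i))
    exact HasDerivAt.comp (0 : ℝ) (by simpa using hf i ⟪w₀, z i⟫_ℝ) hinner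
  have hnorm : HasDerivAt (fun t : ℝ => ‖w₀ + t • G‖ ^ 2) (2 * ⟪w₀, G⟫_ℝ) 0 := by
    simpa using hline.norm_sq
  have hderiv := (HasDerivAt.fun_sum fun i (_ : i ∈ Finset.univ) => hloss i).add
    (hnorm.const_mul (c / 2))
  have hzero := IsLocalMin.hasDerivAt_eq_zero
    (Filter.Eventually.of_forall fun t => by simpa using hmin (w₀ + t • G)) hderiv
  have hself : ⟪G, G⟫_ℝ = 0 := by
    rw [← hzero]
    conv_lhs => rw [hG, inner_add_left, sum_inner, real_inner_smul_left]
    simp only [real_inner_comm G, real_inner_smul_right, ← hG]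
    ring
  exact inner_self_eq_zero.mp hself

/-- Corollary 1 / batch feature-removal worst-case bound.
Under the batch-removal regularized-empirical-risk model and regularity assumptions, if
all embeddings are bounded in norm by `F` and `‖z i - z' i‖ ≤ F / √g` for every `i` in
the removal set `S` of size `m`, then the gradient residual of the unlearned model
satisfies
`‖∇L(w', D')‖ ≤ (γ₂ m² F³ / (λ² n)) · min {4C₁², (γ₁C₁F² + λC₂F)² / (λ² g)}`. -/
theorem gradient_residual_batch_feature_removal
    (d n m : ℕ) (hn : 1 ≤ n) (lam : ℝ) (hlam : 0 < lam)
    -- the loss `ℓ`, twice continuously differentiable in its first argument,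
    -- with first and second partial derivatives `dl` and `ddl`
    (ℓ dl ddl : ℝ → ℝ → ℝ)
    (hdl : ∀ (yy s : ℝ), HasDerivAt (fun t => ℓ t yy) (dl s yy) s)
    (hddl : ∀ (yy s : ℝ), HasDerivAt (fun t => dl t yy) (ddl s yy) s)
    (hddl_cont : ∀ yy : ℝ, Continuous fun s => ddl s yy)
    (hddl_nonneg : ∀ s yy : ℝ, 0 ≤ ddl s yy)
    -- the dataset `D = ((z i, y i))_i` and the updated dataset `D'`, obtained by
    -- replacing the embeddings `z i` by `z' i` for `i` in the removal set `S` of size `m`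
    (z : Fin n → EuclideanSpace ℝ (Fin d)) (y : Fin n → ℝ)
    (S : Finset (Fin n)) (hS : S.card = m)
    (z' : Fin n → EuclideanSpace ℝ (Fin d)) (hz' : ∀ i ∉ S, z' i = z i)
    -- `wstar` minimizes the regularized empirical risk `L(·, D)`
    (wstar : EuclideanSpace ℝ (Fin d))
    (hwstar : ∀ w : EuclideanSpace ℝ (Fin d),
      (∑ i, ℓ ⟪wstar, z i⟫_ℝ (y i)) + lam * n / 2 * ‖wstar‖ ^ 2 ≤
        (∑ i, ℓ ⟪w, z i⟫_ℝ (y i)) + lam * n / 2 * ‖w‖ ^ 2)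
    -- regularity assumptions
    (C1 C2 γ1 γ2 : ℝ)
    (hC1pos : 0 < C1) (hC2pos : 0 < C2) (hγ1pos : 0 < γ1) (hγ2pos : 0 < γ2)
    (hC1 : ∀ (w : EuclideanSpace ℝ (Fin d)) (yy : ℝ) (i : Fin n),
      ‖dl ⟪w, z i⟫_ℝ yy • z i‖ ≤ C1 ∧ ‖dl ⟪w, z' i⟫_ℝ yy • z' i‖ ≤ C1)
    (hC2 : ∀ s yy : ℝ, |dl s yy| ≤ C2)
    (hγ1 : ∀ (yy s t : ℝ), |dl s yy - dl t yy| ≤ γ1 * |s - t|)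
    (hγ2 : ∀ (yy s t : ℝ), |ddl s yy - ddl t yy| ≤ γ2 * |s - t|)
    -- the additional boundedness assumptions
    (F g : ℝ) (hF : 0 < F) (hg : 1 ≤ g)
    (hzF : ∀ i, ‖z i‖ ≤ F) (hz'F : ∀ i, ‖z' i‖ ≤ F)
    (hclose : ∀ i ∈ S, ‖z i - z' i‖ ≤ F / Real.sqrt g)
    -- the Hessian `H = ∇²L(wstar, D')`, the gradient difference `Δ`, and the
    -- unlearned model `w' = wstar + H⁻¹ Δ`
    (H : Matrix (Fin d) (Fin d) ℝ)
    (hH : H = (∑ i, ddl ⟪wstar, z' i⟫_ℝ (y i) • Matrix.vecMulVec (z' i) (z' i)) +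
      (lam * n) • (1 : Matrix (Fin d) (Fin d) ℝ))
    (Δ : EuclideanSpace ℝ (Fin d))
    (hΔ : Δ = ∑ i ∈ S, (dl ⟪wstar, z i⟫_ℝ (y i) • z i - dl ⟪wstar, z' i⟫_ℝ (y i) • z' i))
    (w' : EuclideanSpace ℝ (Fin d))
    (hw' : w' = wstar + Matrix.toEuclideanLin H⁻¹ Δ) :
    -- conclusion: bound on the gradient residual `‖∇L(w', D')‖`
    ‖(∑ i, dl ⟪w', z' i⟫_ℝ (y i) • z' i) + (lam * n) • w'‖ ≤
      γ2 * m ^ 2 * F ^ 3 / (lam ^ 2 * n) *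
        min (4 * C1 ^ 2) ((γ1 * C1 * F ^ 2 + lam * C2 * F) ^ 2 / (lam ^ 2 * g)) := by
  have hn0 : (0 : ℝ) < n := by exact_mod_cast hn
  have hc : 0 < lam * n := mul_pos hlam hn0
  have hsqrt : 0 < √g := Real.sqrt_pos.mpr (by linarith)
  have hgrad : (∑ i, dl ⟪wstar, z i⟫_ℝ (y i) • z i) + (lam * n) • wstar = 0 :=
    regularized_gradient_eq_zero_of_forall_le (f := fun i s => ℓ s (y i))
      (f' := fun i s => dl s (y i)) (fun i s => hdl (y i) s) z (lam * n) hwstar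
  have hwnorm : ‖wstar‖ ≤ C1 / lam := by
    have h : ‖(lam * n) • wstar‖ ≤ n * C1 := by
      rw [eq_neg_of_add_eq_zero_right hgrad, norm_neg]
      refine (norm_sum_le_of_le _ fun i _ => (hC1 wstar (y i) i).1).trans ?_
      simp
    rw [norm_smul, Real.norm_of_nonneg hc.le] at h
    rw [le_div_iff₀ hlam]
    refine le_of_mul_le_mul_left ?_ hn0
    linarith
  have hΔ_crude : ‖Δ‖ ≤ m * (2 * C1) := by
    rw [hΔ]
    refine (norm_sum_le_of_le S (n := fun _ => 2 * C1) fun i _ =>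
      (norm_sub_le _ _).trans ?_).trans ?_
    · linarith [hC1 wstar (y i) i]
    · simp [hS]
  have hΔ_close : ‖Δ‖ ≤ m * ((γ1 * C1 * F ^ 2 + lam * C2 * F) / (lam * √g)) := by
    rw [hΔ]
    refine (norm_sum_le_of_le S
      (n := fun _ => (γ1 * C1 * F ^ 2 + lam * C2 * F) / (lam * √g)) fun i hi => ?_).trans ?_
    · have hsplit : dl ⟪wstar, z i⟫_ℝ (y i) • z i - dl ⟪wstar, z' i⟫_ℝ (y i) • z' i =
          (dl ⟪wstar, z i⟫_ℝ (y i) - dl ⟪wstar, z' i⟫_ℝ (y i)) • z i +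
            dl ⟪wstar, z' i⟫_ℝ (y i) • (z i - z' i) := by
        rw [sub_smul, smul_sub]; abel
      have hinner : |⟪wstar, z i⟫_ℝ - ⟪wstar, z' i⟫_ℝ| ≤ C1 / lam * (F / √g) := by
        rw [← inner_sub_right]
        exact (abs_real_inner_le_norm _ _).trans
          (mul_le_mul hwnorm (hclose i hi) (norm_nonneg _) (by positivity))
      have hdiff := (hγ1 (y i) ⟪wstar, z i⟫_ℝ ⟪wstar, z' i⟫_ℝ).trans
        (mul_le_mul_of_nonneg_left hinner hγ1pos.le)
      rw [hsplit]
      refine (norm_add_le _ _).trans ?_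
      rw [norm_smul, norm_smul, Real.norm_eq_abs, Real.norm_eq_abs]
      calc _ ≤ γ1 * (C1 / lam * (F / √g)) * F + C2 * (F / √g) :=
            add_le_add (mul_le_mul hdiff (hzF i) (norm_nonneg _) (by positivity))
              (mul_le_mul (hC2 _ _) (hclose i hi) (norm_nonneg _) hC2pos.le)
        _ = _ := by field_simp
    · simp [hS]
  have hΔ_sq : ‖Δ‖ ^ 2 ≤
      m ^ 2 * min (4 * C1 ^ 2) ((γ1 * C1 * F ^ 2 + lam * C2 * F) ^ 2 / (lam ^ 2 * g)) := by
    rw [mul_min_of_nonneg _ _ (by positivity)]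
    refine le_min ((pow_le_pow_left₀ (norm_nonneg _) hΔ_crude 2).trans_eq (by ring))
      ((pow_le_pow_left₀ (norm_nonneg _) hΔ_close 2).trans_eq ?_)
    rw [mul_pow, div_pow, mul_pow lam, Real.sq_sqrt (by linarith)]
  have hHapply (v : EuclideanSpace ℝ (Fin d)) : Matrix.toEuclideanLin H v =
      (∑ i, (ddl ⟪wstar, z' i⟫_ℝ (y i) * ⟪v, z' i⟫_ℝ) • z' i) + (lam * n) • v := by
    rw [hH, toEuclideanLin_sum_vecMulVec_add_smul_one]
  have hHlower (v : EuclideanSpace ℝ (Fin d)) :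
      lam * n * ‖v‖ ≤ ‖Matrix.toEuclideanLin H v‖ := by
    rw [hHapply]
    exact mul_norm_le_norm_sum_inner_smul_add_smul (fun i => hddl_nonneg _ _) z' _ v
  have hHinj : Function.Injective (Matrix.toEuclideanLin H) := by
    refine (injective_iff_map_eq_zero _).mpr fun v hv => ?_
    have h := hHlower v
    rw [hv, norm_zero] at h
    exact norm_le_zero_iff.mp (nonpos_of_mul_nonpos_right h hc)
  set u := Matrix.toEuclideanLin H⁻¹ Δ with hu
  have hHu : Matrix.toEuclideanLin H u = Δ := toEuclideanLin_nonsing_inv_apply hHinj Δ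
  have hunorm : ‖u‖ ≤ ‖Δ‖ / (lam * n) := by
    rw [le_div_iff₀' hc, ← hHu]
    exact hHlower u
  have hΔ_univ : Δ = ∑ i, (dl ⟪wstar, z i⟫_ℝ (y i) • z i - dl ⟪wstar, z' i⟫_ℝ (y i) • z' i) := by
    rw [hΔ]
    exact Finset.sum_subset (Finset.subset_univ S) fun i _ hi => by rw [hz' i hi, sub_self]
  have hresidual : (∑ i, dl ⟪w', z' i⟫_ℝ (y i) • z' i) + (lam * n) • w' =
      ∑ i, (dl (⟪wstar, z' i⟫_ℝ + ⟪u, z' i⟫_ℝ) (y i) - dl ⟪wstar, z' i⟫_ℝ (y i) -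
        ddl ⟪wstar, z' i⟫_ℝ (y i) * ⟪u, z' i⟫_ℝ) • z' i := by
    have hnewton := (hHapply u).symm.trans (hHu.trans hΔ_univ)
    rw [Finset.sum_sub_distrib] at hnewton
    simp only [hw', inner_add_left, sub_smul, Finset.sum_sub_distrib, smul_add]
    rw [← sub_eq_zero] at hnewton ⊢
    rw [← add_zero (0 : EuclideanSpace ℝ (Fin d))]
    nth_rewrite 1 [← hnewton]
    rw [← hgrad]
    abel
  rw [hresidual]
  calc _ ≤ ∑ _i : Fin n, γ2 * (‖u‖ * F) ^ 2 * F := by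
        refine norm_sum_le_of_le _ fun i _ => ?_
        rw [norm_smul, Real.norm_eq_abs]
        have hinner : ⟪u, z' i⟫_ℝ ^ 2 ≤ (‖u‖ * F) ^ 2 := by
          rw [← sq_abs]
          exact pow_le_pow_left₀ (abs_nonneg _) ((abs_real_inner_le_norm _ _).trans
            (mul_le_mul_of_nonneg_left (hz'F i) (norm_nonneg _))) 2
        exact mul_le_mul ((abs_sub_sub_deriv_mul_le hγ2pos.le (hddl (y i)) (hγ2 (y i)) _ _).trans
          (mul_le_mul_of_nonneg_left hinner hγ2pos.le)) (hz'F i) (norm_nonneg _) (by positivity)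
    _ = n * γ2 * F ^ 3 * ‖u‖ ^ 2 := by
        simp only [Finset.sum_const, Finset.card_univ, Fintype.card_fin, nsmul_eq_mul]
        ring
    _ ≤ n * γ2 * F ^ 3 * (‖Δ‖ / (lam * n)) ^ 2 := by gcongr
    _ = γ2 * F ^ 3 / (lam ^ 2 * n) * ‖Δ‖ ^ 2 := by field_simp
    _ ≤ γ2 * F ^ 3 / (lam ^ 2 * n) * (m ^ 2 *
          min (4 * C1 ^ 2) ((γ1 * C1 * F ^ 2 + lam * C2 * F) ^ 2 / (lam ^ 2 * g))) := by
        gcongr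
    _ = _ := by ring
end

section
/- Suppose w* ∈ ℝ^d satisfies Σ_{i=1}^n ℓ'(⟨w*,z_i⟩,y_i)·z_i + λ n w* = 0, ‖ℓ'(⟨w*,z_i⟩,y_i)·z_i‖ ≤ C₁ for every i, s ↦ ℓ'(s,y_n) is γ₁-Lipschitz, |ℓ'(s,y_n)| ≤ C₂ for all s, ‖z_n‖ ≤ F, and ‖z_n − z_n'‖ ≤ F/√g for some constants F > 0 and g ≥ 1. Then the gradient-change vector Δ = ℓ'(⟨w*,z_n⟩,y_n)·z_n − ℓ'(⟨w*,z_n'⟩,y_n)·z_n' satisfies ‖Δ‖ ≤ (γ₁ C₁ F² + λ C₂ F) / (λ √g). -/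
open scoped InnerProductSpace BigOperators

/-- A regularized stationary point `w` of `n` samples, each with gradient of norm at most `C`,
satisfies `‖w‖ ≤ C / lam`. -/
theorem norm_le_div_of_sum_add_smul_eq_zero {E : Type*} [NormedAddCommGroup E] [NormedSpace ℝ E]
    {n : ℕ} (hn : 1 ≤ n) {lam C : ℝ} (hlam : 0 < lam) (v : Fin n → E) (w : E)
    (h : (∑ i, v i) + (lam * n) • w = 0) (hv : ∀ i, ‖v i‖ ≤ C) : ‖w‖ ≤ C / lam := by
  have hn' : (0 : ℝ) < n := by exact_mod_cast hn
  have hsum : ‖∑ i, v i‖ ≤ n * C := by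
    simpa using norm_sum_le_of_le Finset.univ (fun i _ => hv i)
  rw [eq_neg_of_add_eq_zero_left h, norm_neg, norm_smul, Real.norm_of_nonneg (by positivity)]
    at hsum
  rw [le_div_iff₀ hlam]
  exact le_of_mul_le_mul_left (by linarith) hn'

/-- under the first-order optimality condition for `wstar`, bounded
per-sample gradients, `γ₁`-Lipschitzness and `C₂`-boundedness of `ℓ'(·, y n)`,
`‖z n‖ ≤ F` and `‖z n − zn'‖ ≤ F/√g`, the gradient-change vector
`Δ = ℓ'(⟪wstar, z n⟫, y n) • z n − ℓ'(⟪wstar, zn'⟫, y n) • zn'` satisfies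
`‖Δ‖ ≤ (γ₁ C₁ F² + λ C₂ F) / (λ √g)`. -/
theorem gradient_change_bound
    (d n : ℕ) (hn : 1 ≤ n) (lam : ℝ) (hlam : 0 < lam)
    (z : Fin n → EuclideanSpace ℝ (Fin d)) (y : Fin n → ℝ)
    (k : Fin n) (zn' : EuclideanSpace ℝ (Fin d))
    (dl : ℝ → ℝ → ℝ) (C1 C2 γ1 : ℝ)
    (hC1pos : 0 < C1) (hC2pos : 0 < C2) (hγ1pos : 0 < γ1)
    (wstar : EuclideanSpace ℝ (Fin d))
    (hopt : (∑ i, dl ⟪wstar, z i⟫_ℝ (y i) • z i) + (lam * n) • wstar = 0)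
    (hC1 : ∀ i, ‖dl ⟪wstar, z i⟫_ℝ (y i) • z i‖ ≤ C1)
    (hγ1 : ∀ s t : ℝ, |dl s (y k) - dl t (y k)| ≤ γ1 * |s - t|)
    (hC2 : ∀ s : ℝ, |dl s (y k)| ≤ C2)
    (F g : ℝ) (hF : 0 < F) (hg : 1 ≤ g)
    (hzF : ‖z k‖ ≤ F) (hclose : ‖z k - zn'‖ ≤ F / Real.sqrt g)
    (Δ : EuclideanSpace ℝ (Fin d))
    (hΔ : Δ = dl ⟪wstar, z k⟫_ℝ (y k) • z k - dl ⟪wstar, zn'⟫_ℝ (y k) • zn') :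
    ‖Δ‖ ≤ (γ1 * C1 * F ^ 2 + lam * C2 * F) / (lam * Real.sqrt g) := by
  have hw := norm_le_div_of_sum_add_smul_eq_zero hn hlam _ wstar hopt hC1
  have hs : 0 < Real.sqrt g := Real.sqrt_pos.2 (by linarith)
  have hdecomp : Δ = (dl ⟪wstar, z k⟫_ℝ (y k) - dl ⟪wstar, zn'⟫_ℝ (y k)) • z k
      + dl ⟪wstar, zn'⟫_ℝ (y k) • (z k - zn') := by
    rw [hΔ]
    module
  have hinner : |⟪wstar, z k⟫_ℝ - ⟪wstar, zn'⟫_ℝ| ≤ C1 / lam * (F / Real.sqrt g) := by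
    rw [← inner_sub_right]
    exact (abs_real_inner_le_norm _ _).trans (by gcongr)
  calc ‖Δ‖ ≤ |dl ⟪wstar, z k⟫_ℝ (y k) - dl ⟪wstar, zn'⟫_ℝ (y k)| * ‖z k‖
        + |dl ⟪wstar, zn'⟫_ℝ (y k)| * ‖z k - zn'‖ := by
        rw [hdecomp]
        refine (norm_add_le _ _).trans_eq ?_
        simp only [norm_smul, Real.norm_eq_abs]
    _ ≤ γ1 * (C1 / lam * (F / Real.sqrt g)) * F + C2 * (F / Real.sqrt g) := by
        gcongr
        · exact (hγ1 _ _).trans (by gcongr)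
        · exact hC2 _
    _ = (γ1 * C1 * F ^ 2 + lam * C2 * F) / (lam * Real.sqrt g) := by
        field_simp
end
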